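/- Let X be a standard Borel space and S a compatible regular sigma-topology on X. Then the Polish topologies contained in S form a club: (a) any countably many sets in S are contained in a Polish topology contained in S, and (b) the topology generated by a countable increasing union of Polish topologies contained in S is Polish and contained in S. -/

import Mathlib

open Set

/-- A `Π⁰₂` set: a countable intersection of sets `(U ⇒ V) = Uᶜ ∪ V` with `U, V` open. -/
def IsPi02 {X : Type*} [TopologicalSpace X] (A : Set X) : Prop :=
  ∃ U V : ℕ → Set X, (∀ n, IsOpen (U n)) ∧ (∀ n, IsOpen (V n)) ∧
    A = ⋂ n, ((U n)ᶜ ∪ V n)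

/-- A quasi-Polish space: homeomorphic (via an embedding) to a `Π⁰₂` subspace of
the countable power `ℕ → Prop` of the Sierpiński space. -/
def QuasiPolish (X : Type*) [TopologicalSpace X] : Prop :=
  ∃ f : X → (ℕ → Prop), Topology.IsEmbedding f ∧ IsPi02 (Set.range f)

/-- A sigma-topology: a collection of subsets closed under countable unions and
finite intersections. -/
def IsSigmaTopology {X : Type*} (S : Set (Set X)) : Prop :=
  ∅ ∈ S ∧ Set.univ ∈ S ∧
  (∀ f : ℕ → Set X, (∀ n, f n ∈ S) → (⋃ n, f n) ∈ S) ∧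
  (∀ A B : Set X, A ∈ S → B ∈ S → A ∩ B ∈ S)

/-- A regular sigma-topology: every `U ∈ S` is a countable union of sets
`V n ∈ S` each contained in some `F n ⊆ U` with `(F n)ᶜ ∈ S`. -/
def IsRegularSigmaTopology {X : Type*} (S : Set (Set X)) : Prop :=
  IsSigmaTopology S ∧
  ∀ U ∈ S, ∃ V F : ℕ → Set X,
    (∀ n, V n ∈ S) ∧ (∀ n, (F n)ᶜ ∈ S) ∧ (∀ n, V n ⊆ F n) ∧ (∀ n, F n ⊆ U) ∧
    U = ⋃ n, V n

/-- A topology on a standard Borel space is a compatible quasi-Polish topology if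
it is quasi-Polish and its Borel sigma-algebra is the given one. -/
def IsCompatibleQuasiPolishTopology {X : Type*} [m : MeasurableSpace X]
    (t : TopologicalSpace X) : Prop :=
  @QuasiPolish X t ∧ m = @borel X t

/-- A sigma-topology `S` on a standard Borel space is compatible if any countably
many sets in `S` are contained in a single compatible quasi-Polish topology
contained in `S`. -/
def IsCompatibleSigmaTopology {X : Type*} [MeasurableSpace X] (S : Set (Set X)) : Prop :=
  IsSigmaTopology S ∧
  ∀ f : ℕ → Set X, (∀ n, f n ∈ S) →
    ∃ t : TopologicalSpace X, IsCompatibleQuasiPolishTopology t ∧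
      {A : Set X | @IsOpen X t A} ⊆ S ∧ ∀ n, @IsOpen X t (f n)

section

open scoped Topology

theorem IsPi02.iInter {Y : Type*} [TopologicalSpace Y] {A : ℕ → Set Y}
    (hA : ∀ n, IsPi02 (A n)) : IsPi02 (⋂ n, A n) := by
  choose U V hU hV hA using hA
  refine ⟨fun k => U k.unpair.1 k.unpair.2, fun k => V k.unpair.1 k.unpair.2,
    fun _ => hU _ _, fun _ => hV _ _, ?_⟩
  ext y
  simp only [mem_iInter]
  constructor
  · intro h k
    have h1 := h k.unpair.1
    rw [hA, mem_iInter] at h1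
    exact h1 _
  · intro h n
    rw [hA, mem_iInter]
    intro k
    simpa using h (Nat.pair n k)

theorem IsPi02.inter {Y : Type*} [TopologicalSpace Y] {A B : Set Y}
    (hA : IsPi02 A) (hB : IsPi02 B) : IsPi02 (A ∩ B) := by
  have h : IsPi02 (⋂ n : ℕ, if n = 0 then A else B) :=
    IsPi02.iInter fun n => by split_ifs <;> assumption
  convert h using 1
  ext y
  simp only [mem_inter_iff, mem_iInter]
  exact ⟨fun h n => by split_ifs; exacts [h.1, h.2], fun h => ⟨h 0, h 1⟩⟩

theorem IsPi02.preimage {Y Z : Type*} [TopologicalSpace Y] [TopologicalSpace Z] {A : Set Z}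
    (hA : IsPi02 A) {g : Y → Z} (hg : Continuous g) : IsPi02 (g ⁻¹' A) := by
  obtain ⟨U, V, hU, hV, rfl⟩ := hA
  exact ⟨fun n => g ⁻¹' U n, fun n => g ⁻¹' V n, fun n => (hU n).preimage hg,
    fun n => (hV n).preimage hg, by simp [preimage_iInter]⟩

theorem isPi02_setOf_iff {Y : Type*} [TopologicalSpace Y] {U V : Set Y}
    (hU : IsOpen U) (hV : IsOpen V) : IsPi02 {y | y ∈ U ↔ y ∈ V} := by
  have h (A B : Set Y) (hA : IsOpen A) (hB : IsOpen B) : IsPi02 (Aᶜ ∪ B) :=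
    ⟨fun _ => A, fun _ => B, fun _ => hA, fun _ => hB, (iInter_const _).symm⟩
  convert (h U V hU hV).inter (h V U hV hU) using 1
  ext y
  simp only [mem_ofPred_eq, mem_inter_iff, mem_union, mem_compl_iff]
  tauto

theorem IsPi02.isGδ {Y : Type*} [TopologicalSpace Y] [TopologicalSpace.MetrizableSpace Y]
    {A : Set Y} (hA : IsPi02 A) : IsGδ A := by
  let := TopologicalSpace.metrizableSpaceMetric Y
  obtain ⟨U, V, hU, hV, rfl⟩ := hA
  exact IsGδ.iInter fun n => (hU n).isClosed_compl.isGδ.union (hV n).isGδ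

/-- A `Gδ` subset of a Polish space is Polish. -/
theorem IsGδ.polishSpace_coe {Z : Type*} [TopologicalSpace Z] [PolishSpace Z] {G : Set Z}
    (hG : IsGδ G) : PolishSpace G := by
  obtain ⟨U, hU, rfl⟩ := isGδ_iff_eq_iInter_nat.1 hG
  have (n : ℕ) : PolishSpace (U n) := (hU n).polishSpace
  let d : (⋂ n, U n : Set Z) → ∀ n, U n := fun z n => ⟨z, mem_iInter.1 z.2 n⟩
  have hd : Continuous d := by fun_prop
  have hp : Continuous fun y : ∀ n, U n => (y 0 : Z) := by fun_prop
  have he : Topology.IsEmbedding d :=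
    .of_comp hd hp (Topology.IsEmbedding.subtypeVal (p := fun z => z ∈ ⋂ n, U n))
  refine Topology.IsClosedEmbedding.polishSpace (f := d) ⟨he, ?_⟩
  have hr : range d = ⋂ n, {y : ∀ n, U n | (y n : Z) = y 0} := by
    ext y
    simp only [mem_range, mem_iInter, mem_ofPred_eq]
    constructor
    · rintro ⟨z, rfl⟩ n
      rfl
    · intro h
      exact ⟨⟨y 0, mem_iInter.2 fun n => h n ▸ (y n).2⟩, funext fun n => Subtype.ext (h n).symm⟩
  rw [hr]
  exact isClosed_iInter fun n => isClosed_eq (by fun_prop) (by fun_prop)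

/-- A metrizable separable space with a `Π⁰₂` embedding in a power of the Sierpiński space
is Polish. -/
theorem polishSpace_of_isPi02_range {X ι : Type*} [TopologicalSpace X]
    [TopologicalSpace.MetrizableSpace X] [TopologicalSpace.SeparableSpace X]
    {f : X → ι → Prop} (hf : Topology.IsEmbedding f) (hR : IsPi02 (range f)) :
    PolishSpace X := by
  let := TopologicalSpace.metrizableSpaceMetric X
  let e : X → UniformSpace.Completion X := fun x => x
  have he : Isometry e := UniformSpace.Completion.coe_isometry
  have hB (k : ι) : ∃ O : Set (UniformSpace.Completion X), IsOpen O ∧ e ⁻¹' O = {x | f x k} :=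
    he.isEmbedding.isInducing.isOpen_iff.1
      (continuous_Prop.1 ((continuous_apply k).comp hf.continuous))
  choose O hO hOf using hB
  let g : UniformSpace.Completion X → ι → Prop := fun z k => z ∈ O k
  have hg : Continuous g := continuous_pi fun k => continuous_Prop.2 (hO k)
  have hge (x : X) : g (e x) = f x := funext fun k => congrArg (x ∈ ·) (hOf k)
  let W (n : ℕ) : Set (ι → Prop) :=
    ⋃₀ {W | IsOpen W ∧ ∀ a b, f a ∈ W → f b ∈ W → dist a b ≤ 1 / ((n : ℝ) + 1)}
  have hW (n : ℕ) : IsOpen (W n) := isOpen_sUnion fun _ h => h.1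
  have hG : IsGδ (g ⁻¹' range f ∩ ⋂ n, g ⁻¹' W n) :=
    (hR.preimage hg).isGδ.inter (.iInter_of_isOpen fun n => (hW n).preimage hg)
  have hr : range e = g ⁻¹' range f ∩ ⋂ n, g ⁻¹' W n := by
    ext z
    constructor
    · rintro ⟨x, rfl⟩
      refine ⟨⟨x, (hge x).symm⟩, mem_iInter.2 fun n => ?_⟩
      obtain ⟨V, hV, hVb⟩ := hf.isInducing.isOpen_iff.1
        (Metric.isOpen_ball (x := x) (ε := 1 / ((n : ℝ) + 1) / 2))
      have hmem (a : X) : f a ∈ V ↔ dist a x < 1 / ((n : ℝ) + 1) / 2 := by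
        rw [← mem_preimage, hVb, Metric.mem_ball]
      refine ⟨V, ⟨hV, fun a b ha hb => ?_⟩, ?_⟩
      · have := dist_triangle_right a b x
        linarith [(hmem a).1 ha, (hmem b).1 hb]
      · rw [hge, hmem, dist_self]
        positivity
    · rintro ⟨⟨x, hx⟩, hz⟩
      refine ⟨x, ?_⟩
      have hdist (n : ℕ) : dist z (e x) ≤ 1 / ((n : ℝ) + 1) := by
        obtain ⟨V, ⟨hV, hVd⟩, hzV⟩ := mem_iInter.1 hz n
        have hcl : z ∈ closure (g ⁻¹' V ∩ range e) :=
          UniformSpace.Completion.denseRange_coe.open_subset_closure_inter (hV.preimage hg) hzV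
        have hsub : g ⁻¹' V ∩ range e ⊆ Metric.closedBall (e x) (1 / ((n : ℝ) + 1)) := by
          rintro _ ⟨ha, a, rfl⟩
          rw [Metric.mem_closedBall, he.dist_eq]
          refine hVd a x ?_ ?_
          · rwa [mem_preimage, hge] at ha
          · rwa [hx]
        exact closure_minimal hsub Metric.isClosed_closedBall hcl
      refine (dist_le_zero.1 (ge_of_tendsto' tendsto_one_div_add_atTop_nhds_zero_nat hdist)).symm
  rw [← hr] at hG
  have : PolishSpace (range e) := hG.polishSpace_coe
  exact he.isEmbedding.toHomeomorph.isClosedEmbedding.polishSpace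

theorem QuasiPolish.secondCountableTopology {X : Type*} [TopologicalSpace X]
    (h : QuasiPolish X) : SecondCountableTopology X := by
  obtain ⟨f, hf, -⟩ := h
  exact hf.secondCountableTopology

/-- The join of countably many quasi-Polish topologies having a coarsest one among them embeds
as a `Π⁰₂` subspace of a countable power of the Sierpiński space. -/
theorem exists_isEmbedding_isPi02_range_iInf {X : Type*} {t : ℕ → TopologicalSpace X}
    (hle : ∀ n, t n ≤ t 0) (ht : ∀ n, @QuasiPolish X (t n)) :
    ∃ f : X → ℕ × ℕ → Prop, @Topology.IsEmbedding _ _ (⨅ n, t n) _ f ∧ IsPi02 (range f) := by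
  have h (n : ℕ) : ∃ f : X → ℕ → Prop, Function.Injective f ∧
      t n = TopologicalSpace.induced f inferInstance ∧ IsPi02 (range f) := by
    let := t n
    obtain ⟨f, hf, hR⟩ := ht n
    exact ⟨f, hf.injective, hf.eq_induced, hR⟩
  choose f hinj hind hR using h
  have hW (n k : ℕ) : ∃ W : Set (ℕ → Prop), IsOpen W ∧ f n ⁻¹' W = {x | f 0 x k} := by
    rw [← isOpen_induced_iff, ← hind n]
    refine hle n _ ?_
    rw [hind 0, isOpen_induced_iff]
    exact ⟨{y | y k}, continuous_Prop.1 (continuous_apply k), rfl⟩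
  choose W hWo hW using hW
  have hWf (n k : ℕ) (x : X) : f n x ∈ W n k ↔ f 0 x k := Set.ext_iff.1 (hW n k) x
  let p (n : ℕ) (y : ℕ × ℕ → Prop) : ℕ → Prop := fun k => y (n, k)
  have hp (n : ℕ) : Continuous (p n) := by fun_prop
  refine ⟨fun x i => f i.1 x i.2, ?_, ?_⟩
  · refine @Topology.IsEmbedding.mk _ _ (⨅ n, t n) _ _ ?_ ?_
    · refine @Topology.IsInducing.mk _ _ (⨅ n, t n) _ _ ?_
      have h (n : ℕ) : t n = ⨅ k, TopologicalSpace.induced (fun x => f n x k) inferInstance := by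
        rw [hind n]
        simp [Pi.topologicalSpace, induced_iInf, induced_compose, Function.comp_def]
      simp only [Pi.topologicalSpace, induced_iInf, induced_compose, Function.comp_def,
        iInf_prod]
      exact iInf_congr h
    · exact fun x y h => hinj 0 (funext fun k => congrFun h (0, k))
  · have hr : (range fun (x : X) (i : ℕ × ℕ) => f i.1 x i.2) =
        ⋂ n, (p n ⁻¹' range (f n) ∩ ⋂ k, {y | y ∈ {y | y (0, k)} ↔ y ∈ p n ⁻¹' W n k}) := by
      ext y
      simp only [mem_iInter, mem_inter_iff, mem_ofPred_eq, mem_preimage]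
      constructor
      · rintro ⟨x, rfl⟩ n
        exact ⟨⟨x, rfl⟩, fun k => (hWf n k x).symm⟩
      · intro h
        choose h1 h2 using h
        choose x hx using h1
        have hxx (n : ℕ) : x n = x 0 := hinj 0 <| funext fun k => propext <| by
          rw [← hWf n k, hx n, ← h2 n k, hx 0]
        refine ⟨x 0, funext fun i => ?_⟩
        have := congrFun (hx i.1) i.2
        rwa [hxx] at this
    rw [hr]
    refine .iInter fun n => ((hR n).preimage (hp n)).inter (.iInter fun k => ?_)
    exact isPi02_setOf_iff (continuous_Prop.1 (continuous_apply _)) ((hWo n k).preimage (hp n))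

theorem isTopologicalBasis_iUnion_isOpen {X : Type*} {t : ℕ → TopologicalSpace X}
    (ht : Antitone t) :
    @TopologicalSpace.IsTopologicalBasis X (⨅ n, t n) (⋃ n, {A | IsOpen[t n] A}) := by
  refine @TopologicalSpace.IsTopologicalBasis.mk X (⨅ n, t n) _ ?_ ?_ ?_
  · intro A hA B hB x hx
    obtain ⟨i, hi⟩ := mem_iUnion.1 hA
    obtain ⟨j, hj⟩ := mem_iUnion.1 hB
    refine ⟨A ∩ B, mem_iUnion.2 ⟨max i j, ?_⟩, hx, Subset.rfl⟩
    exact @IsOpen.inter X (t (max i j)) _ _ (ht (le_max_left i j) _ hi)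
      (ht (le_max_right i j) _ hj)
  · exact eq_univ_of_univ_subset <| subset_sUnion_of_mem <|
      mem_iUnion.2 ⟨0, @isOpen_univ X (t 0)⟩
  · exact (generateFrom_iUnion_isOpen t).symm

/-- Sets open in the join of an increasing sequence of second countable topologies belong to
every class closed under countable unions that contains all those topologies. -/
theorem mem_of_isOpen_iInf {X : Type*} {t : ℕ → TopologicalSpace X} (ht : Antitone t)
    (h2 : ∀ n, @SecondCountableTopology X (t n)) {S : Set (Set X)}
    (hS : ∀ f : ℕ → Set X, (∀ n, f n ∈ S) → (⋃ n, f n) ∈ S)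
    (htS : ∀ n, {A | IsOpen[t n] A} ⊆ S) {U : Set X} (hU : IsOpen[⨅ n, t n] U) : U ∈ S := by
  let := ⨅ n, t n
  have : SecondCountableTopology X := TopologicalSpace.secondCountableTopology_iInf h2
  obtain ⟨s, hs, hsc, rfl⟩ :=
    (isTopologicalBasis_iUnion_isOpen ht).exists_countable_biUnion_of_isOpen hU
  rcases s.eq_empty_or_nonempty with rfl | hne
  · simpa using htS 0 (@isOpen_empty X (t 0))
  · obtain ⟨u, rfl⟩ := hsc.exists_eq_range hne
    rw [biUnion_range]
    refine hS u fun n => ?_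
    obtain ⟨i, hi⟩ := mem_iUnion.1 (hs (mem_range_self n))
    exact htS i hi

theorem eq_borel_iInf {X : Type*} [m : MeasurableSpace X] {t : ℕ → TopologicalSpace X}
    (ht : Antitone t) (h2 : ∀ n, @SecondCountableTopology X (t n))
    (hm : ∀ n, m = @borel X (t n)) : m = @borel X (⨅ n, t n) := by
  refine le_antisymm ?_ ?_
  · rw [hm 0]
    exact borel_anti (iInf_le t 0)
  · refine MeasurableSpace.generateFrom_le fun U hU => ?_
    refine mem_of_isOpen_iInf (S := {A | MeasurableSet A}) ht h2
      (fun f hf => MeasurableSet.iUnion hf) (fun n A hA => ?_) hU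
    rw [mem_ofPred_eq, hm n]
    exact MeasurableSpace.measurableSet_generateFrom hA

theorem regularSpace_iInf_of_antitone {X : Type*} {t : ℕ → TopologicalSpace X} (ht : Antitone t)
    (hreg : ∀ n U, IsOpen[t n] U → ∀ x ∈ U, ∃ V F : Set X, IsOpen[t (n + 1)] V ∧
      IsOpen[t (n + 1)] Fᶜ ∧ x ∈ V ∧ V ⊆ F ∧ F ⊆ U) :
    @RegularSpace X (⨅ n, t n) := by
  let := ⨅ n, t n
  refine .of_exists_mem_nhds_isClosed_subset fun x s hs => ?_
  obtain ⟨U, hU, hxU, hUs⟩ := (isTopologicalBasis_iUnion_isOpen ht).mem_nhds_iff.1 hs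
  obtain ⟨n, hn⟩ := mem_iUnion.1 hU
  obtain ⟨V, F, hV, hF, hxV, hVF, hFU⟩ := hreg n U hn x hxU
  exact ⟨F, Filter.mem_of_superset (IsOpen.mem_nhds (iInf_le t (n + 1) _ hV) hxV) hVF,
    ⟨iInf_le t (n + 1) _ hF⟩, hFU.trans hUs⟩

/-- Every compatible quasi-Polish topology contained in a compatible regular sigma-topology
refines to another one witnessing its regularity. -/
theorem exists_compatible_le_regular {X : Type*} [MeasurableSpace X] {S : Set (Set X)}
    (hreg : IsRegularSigmaTopology S) (hcomp : IsCompatibleSigmaTopology S)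
    {t : TopologicalSpace X} (ht : IsCompatibleQuasiPolishTopology t)
    (htS : {A | IsOpen[t] A} ⊆ S) :
    ∃ t' : TopologicalSpace X, IsCompatibleQuasiPolishTopology t' ∧ {A | IsOpen[t'] A} ⊆ S ∧
      t' ≤ t ∧ ∀ U, IsOpen[t] U → ∀ x ∈ U, ∃ V F : Set X, IsOpen[t'] V ∧ IsOpen[t'] Fᶜ ∧
        x ∈ V ∧ V ⊆ F ∧ F ⊆ U := by
  have := ht.1.secondCountableTopology
  obtain ⟨b, hb⟩ := TopologicalSpace.exists_seq_basis X
  have hgen := hb.eq_generateFrom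
  have hbasis {U : Set X} {x : X} (hx : x ∈ U) (hU : IsOpen U) :
      ∃ v ∈ range b, x ∈ v ∧ v ⊆ U := hb.exists_subset_of_mem_open hx hU
  have hbS (n : ℕ) : b n ∈ S := htS (hb.isOpen (mem_range_self n))
  choose V F hV hF hVF hFb hbV using fun n => hreg.2 (b n) (hbS n)
  let c : ℕ ⊕ (ℕ × ℕ) ⊕ (ℕ × ℕ) → Set X :=
    Sum.elim b (Sum.elim (fun i => V i.1 i.2) fun i => (F i.1 i.2)ᶜ)
  have hc (i) : c i ∈ S := by
    rcases i with n | i | i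
    exacts [hbS n, hV _ _, hF _ _]
  obtain ⟨e, he⟩ := exists_surjective_nat (ℕ ⊕ (ℕ × ℕ) ⊕ (ℕ × ℕ))
  obtain ⟨t', ht', ht'S, hopen⟩ := hcomp.2 (fun n => c (e n)) fun n => hc (e n)
  have hopen' (i) : IsOpen[t'] (c i) := by
    obtain ⟨n, rfl⟩ := he i
    exact hopen n
  refine ⟨t', ht', ht'S, ?_, fun U hU x hx => ?_⟩
  · rw [hgen]
    refine le_generateFrom ?_
    rintro _ ⟨n, rfl⟩
    exact hopen' (.inl n)
  · obtain ⟨_, ⟨n, rfl⟩, hxb, hbU⟩ := hbasis hx hU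
    rw [hbV n] at hxb
    obtain ⟨k, hk⟩ := mem_iUnion.1 hxb
    exact ⟨V n k, F n k, hopen' (.inr (.inl (n, k))), hopen' (.inr (.inr (n, k))), hk,
      hVF n k, (hFb n k).trans hbU⟩

theorem exists_polishSpace_isOpen {X : Type*} [m : MeasurableSpace X] {S : Set (Set X)}
    (hreg : IsRegularSigmaTopology S) (hcomp : IsCompatibleSigmaTopology S)
    (f : ℕ → Set X) (hf : ∀ n, f n ∈ S) :
    ∃ t : TopologicalSpace X, @PolishSpace X t ∧ m = @borel X t ∧
      {A | IsOpen[t] A} ⊆ S ∧ ∀ n, IsOpen[t] (f n) := by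
  obtain ⟨t₀, ht₀, ht₀S, hf₀⟩ := hcomp.2 f hf
  let T := {t : TopologicalSpace X // IsCompatibleQuasiPolishTopology t ∧ {A | IsOpen[t] A} ⊆ S}
  have hstep (t : T) : ∃ t' : T, t'.1 ≤ t.1 ∧ ∀ U, IsOpen[t.1] U → ∀ x ∈ U, ∃ V F : Set X,
      IsOpen[t'.1] V ∧ IsOpen[t'.1] Fᶜ ∧ x ∈ V ∧ V ⊆ F ∧ F ⊆ U := by
    obtain ⟨t', h1, h2, h3⟩ := exists_compatible_le_regular hreg hcomp t.2.1 t.2.2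
    exact ⟨⟨t', h1, h2⟩, h3⟩
  choose next hle hnext using hstep
  let s : ℕ → T := fun n => Nat.rec ⟨t₀, ht₀, ht₀S⟩ (fun _ t => next t) n
  let t : ℕ → TopologicalSpace X := fun n => (s n).1
  have ht : Antitone t := antitone_nat_of_succ_le fun n => hle (s n)
  have hq (n : ℕ) : @QuasiPolish X (t n) := (s n).2.1.1
  have h2 (n : ℕ) : @SecondCountableTopology X (t n) :=
    @QuasiPolish.secondCountableTopology X (t n) (hq n)
  obtain ⟨φ, hφ, hR⟩ := exists_isEmbedding_isPi02_range_iInf (fun n => ht n.zero_le) hq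
  refine ⟨⨅ n, t n, ?_, eq_borel_iInf ht h2 fun n => (s n).2.1.2,
    fun U hU => mem_of_isOpen_iInf ht h2 hcomp.1.2.2.1 (fun n => (s n).2.2) hU,
    fun n => iInf_le t 0 _ (hf₀ n)⟩
  let := ⨅ n, t n
  have : SecondCountableTopology X := TopologicalSpace.secondCountableTopology_iInf h2
  have : RegularSpace X := regularSpace_iInf_of_antitone ht fun n => hnext (s n)
  have : T0Space X := hφ.t0Space
  exact polishSpace_of_isPi02_range hφ hR

end

/-- If `S` is a compatible regular sigma-topology on a standard
Borel space `X`, then the Polish topologies contained in `S` form a club: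
(a) any countably many sets in `S` are contained in a (compatible) Polish topology
contained in `S`; (b) the topology generated by a countable increasing union of
(compatible) Polish topologies contained in `S` is Polish and contained in `S`. -/
theorem stmt_17 {X : Type*} [m : MeasurableSpace X] [StandardBorelSpace X]
    (S : Set (Set X)) (hreg : IsRegularSigmaTopology S)
    (hcomp : IsCompatibleSigmaTopology S) :
    (∀ f : ℕ → Set X, (∀ n, f n ∈ S) →
      ∃ t : TopologicalSpace X, @PolishSpace X t ∧ m = @borel X t ∧
        {A : Set X | @IsOpen X t A} ⊆ S ∧ ∀ n, @IsOpen X t (f n)) ∧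
    (∀ t : ℕ → TopologicalSpace X,
      (∀ n, @PolishSpace X (t n)) → (∀ n, m = @borel X (t n)) →
      (∀ n, {A : Set X | @IsOpen X (t n) A} ⊆ S) →
      (∀ n, {A : Set X | @IsOpen X (t n) A} ⊆ {A : Set X | @IsOpen X (t (n + 1)) A}) →
      @PolishSpace X (TopologicalSpace.generateFrom (⋃ n, {A : Set X | @IsOpen X (t n) A})) ∧
      m = @borel X (TopologicalSpace.generateFrom (⋃ n, {A : Set X | @IsOpen X (t n) A})) ∧
      {A : Set X | @IsOpen X (TopologicalSpace.generateFrom (⋃ n, {A : Set X | @IsOpen X (t n) A})) A} ⊆ S) := by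
  refine ⟨exists_polishSpace_isOpen hreg hcomp, fun t hP hm htS hmono => ?_⟩
  have ht : Antitone t := antitone_nat_of_succ_le fun n A hA => hmono n hA
  have h2 (n : ℕ) : @SecondCountableTopology X (t n) :=
    @PolishSpace.toSecondCountableTopology X (t n) (hP n)
  rw [generateFrom_iUnion_isOpen t]
  exact ⟨PolishSpace.iInf ⟨0, fun n => ht n.zero_le⟩ hP, eq_borel_iInf ht h2 hm,
    fun U hU => mem_of_isOpen_iInf ht h2 hcomp.1.2.2.1 htS hU⟩
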